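/- arXiv:1201.1574 — 13 statements merged into one kernel-verified Lean document; each statement's English description precedes it below -/
import Mathlib

section
/- Let φ ∈ G, Ψ ∈ H and J ∈ M (with respect to X, Λ, Y, y₀). Then for each real number μ > θ(φ,Ψ,J) and each filtering cover N of X, there exists A ∈ N such that sup_{λ∈Λ} inf_{x∈A} (J(x) − μ·φ(Ψ(x,λ))) < inf_{x∈A} sup_{z∈A} (J(x) − μ·φ(Ψ(x,λ_z))). -/
open Set Filter Topology

noncomputable def ricceriTheta {X Λ Y : Type*} (φ : Y → ℝ) (Ψ : X → Λ → Y)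
    (lam : X → Λ) (J : X → ℝ) : ℝ :=
  sInf {r : ℝ | ∃ u x, (∀ z, J u ≤ J z) ∧ lam x ≠ lam u ∧
    r = (J x - J u) / φ (Ψ x (lam u))}

theorem stmt0 {X Λ Y : Type*} [Nonempty X] [TopologicalSpace Λ]
    [TopologicalSpace Y] (y₀ : Y)
    (φ : Y → ℝ) (hφ_lsc : LowerSemicontinuous φ) (hφ0 : ∀ y, 0 ≤ φ y)
    (hφz : ∀ y, φ y = 0 ↔ y = y₀)
    (hφV : ∀ V ∈ 𝓝 y₀, ∃ c > 0, ∀ y ∉ V, c ≤ φ y)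
    (Ψ : X → Λ → Y)
    (hΨc : ∀ x, Continuous (Ψ x)) (hΨi : ∀ x, Function.Injective (Ψ x))
    (hΨo : ∀ x, IsOpenMap (Ψ x))
    (lam : X → Λ) (hlam : ∀ x, Ψ x (lam x) = y₀)
    (hlamnc : ∃ x x', lam x ≠ lam x')
    (J : X → ℝ) (hJ : ∃ u, ∀ x, J u ≤ J x)
    (μ : ℝ) (hμ : ricceriTheta φ Ψ lam J < μ)
    (N : Set (Set X)) (hNne : ∀ A ∈ N, A.Nonempty) (hNcov : ⋃₀ N = univ)
    (hNfil : ∀ A₁ ∈ N, ∀ A₂ ∈ N, ∃ A₃ ∈ N, A₁ ∪ A₂ ⊆ A₃) :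
    ∃ A ∈ N,
      (⨆ l : Λ, ⨅ x : A, ((J x - μ * φ (Ψ x l) : ℝ) : EReal)) <
      ⨅ x : A, ⨆ z : A, ((J x - μ * φ (Ψ x (lam z)) : ℝ) : EReal) := by
  obtain ⟨u₀, hu₀⟩ := hJ
  have hφpos : ∀ x l, l ≠ lam x → 0 < φ (Ψ x l) := fun x l hl =>
    (hφ0 _).lt_of_ne' fun h => hl (hΨi x (((hφz _).1 h).trans (hlam x).symm))
  have hne : {r : ℝ | ∃ u x, (∀ z, J u ≤ J z) ∧ lam x ≠ lam u ∧
      r = (J x - J u) / φ (Ψ x (lam u))}.Nonempty := by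
    obtain ⟨x, x', hxx'⟩ := hlamnc
    by_cases h : lam x = lam u₀
    · exact ⟨_, u₀, x', hu₀, fun h' => hxx' (h.trans h'.symm), rfl⟩
    · exact ⟨_, u₀, x, hu₀, h, rfl⟩
  obtain ⟨_, ⟨u, x₁, hu, hne₁, rfl⟩, hlt⟩ := exists_lt_of_csInf_lt hne hμ
  have hpos := hφpos x₁ (lam u) hne₁.symm
  have hμ0 : 0 < μ := (div_nonneg (sub_nonneg.2 (hu x₁)) hpos.le).trans_lt hlt
  rw [div_lt_iff₀ hpos] at hlt
  obtain ⟨r, hr₁, hr₂⟩ :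
      ∃ r, J x₁ - μ * φ (Ψ x₁ (lam u)) < r ∧ r < J u := exists_between (by linarith)
  have hnhds : {l | (J x₁ - r) / μ < φ (Ψ x₁ l)} ∈ 𝓝 (lam u) :=
    (hφ_lsc.comp (hΨc x₁)) (lam u) _ ((div_lt_iff₀ hμ0).2 (by
      rw [Function.comp_apply]
      linarith))
  obtain ⟨c, hc, hcφ⟩ := hφV _ (hlam u ▸ (hΨo u).image_mem_nhds hnhds)
  obtain ⟨A₁, hA₁, huA₁⟩ : u ∈ ⋃₀ N := hNcov ▸ mem_univ u
  obtain ⟨A₂, hA₂, hxA₂⟩ : x₁ ∈ ⋃₀ N := hNcov ▸ mem_univ x₁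
  obtain ⟨A, hA, hsub⟩ := hNfil A₁ hA₁ A₂ hA₂
  have hupper : (⨆ l : Λ, ⨅ x : A, ((J x - μ * φ (Ψ x l) : ℝ) : EReal)) ≤
      ((max r (J u - μ * c) : ℝ) : EReal) := by
    refine iSup_le fun l => ?_
    by_cases hl : (J x₁ - r) / μ < φ (Ψ x₁ l)
    · refine (iInf_le _ ⟨x₁, hsub (Or.inr hxA₂)⟩).trans
        (EReal.coe_le_coe_iff.2 (le_max_of_le_left ?_))
      rw [div_lt_iff₀ hμ0] at hl
      linarith
    · refine (iInf_le _ ⟨u, hsub (Or.inl huA₁)⟩).trans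
        (EReal.coe_le_coe_iff.2 (le_max_of_le_right ?_))
      have hcl : c ≤ φ (Ψ u l) := hcφ _ fun h => hl ((hΨi u).mem_set_image.1 h)
      gcongr
  have hlower : (J u : EReal) ≤
      ⨅ x : A, ⨆ z : A, ((J x - μ * φ (Ψ x (lam z)) : ℝ) : EReal) := by
    refine le_iInf fun x => le_iSup_of_le x (EReal.coe_le_coe_iff.2 ?_)
    simpa [(hφz _).2 (hlam x)] using hu x
  refine ⟨A, hA, hupper.trans_lt (lt_of_lt_of_le (EReal.coe_lt_coe_iff.2 ?_) hlower)⟩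
  exact max_lt hr₂ (sub_lt_self _ (mul_pos hμ0 hc))
end

section
/- Let X be a nonempty set, Y a real inner product space, I : X → ℝ, Φ : X → Y, and μ > 0 such that the function x ↦ I(x) + μ‖Φ(x)‖² has a global minimum and the function x ↦ Φ(x) is not constant. Then at least one of the following holds: (a) for each filtering cover N of X there exists A ∈ N such that sup_{λ∈Y} inf_{x∈A} (I(x) + μ(2⟨Φ(x),λ⟩ − ‖λ‖²)) < inf_{x∈A} sup_{λ∈Φ(A)} (I(x) + μ(2⟨Φ(x),λ⟩ − ‖λ‖²)); (b) for each global minimum u of x ↦ I(x) + μ‖Φ(x)‖², one has I(u) ≤ I(x) + 2μ(⟨Φ(x),Φ(u)⟩ − ‖Φ(u)‖²) for all x ∈ X. -/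
open Set Filter Topology RealInnerProductSpace

/-- If the paraboloid `m - μ * ‖v - l‖ ^ 2` is paired with a continuous function whose value at `v`
is less than `m`, then the pointwise minimum of the two is bounded away from `m`. -/
theorem exists_lt_forall_le_or_le {Y : Type*} [NormedAddCommGroup Y] {μ m : ℝ} (hμ : 0 < μ)
    {v : Y} {g : Y → ℝ} (hg : ContinuousAt g v) (hgv : g v < m) :
    ∃ c < m, ∀ l, m - μ * ‖v - l‖ ^ 2 ≤ c ∨ g l ≤ c := by
  obtain ⟨d, hd, hdm⟩ := exists_between hgv
  obtain ⟨r, hr, hball⟩ := Metric.eventually_nhds_iff.1 (hg.eventually (gt_mem_nhds hd))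
  have hr2 : 0 < μ * r ^ 2 := by positivity
  refine ⟨max d (m - μ * r ^ 2), max_lt hdm (by linarith), fun l ↦ ?_⟩
  by_cases hl : dist l v < r
  · exact Or.inr ((hball hl).le.trans (le_max_left _ _))
  · refine Or.inl (le_trans ?_ (le_max_right _ _))
    have hrl : r ≤ ‖v - l‖ := by
      rw [← dist_eq_norm, dist_comm]
      exact not_lt.1 hl
    gcongr

theorem stmt3 {X Y : Type*} [Nonempty X]
    [NormedAddCommGroup Y] [InnerProductSpace ℝ Y]
    (I : X → ℝ) (Φ : X → Y) (μ : ℝ) (hμ : 0 < μ)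
    (hmin : ∃ u, ∀ x, I u + μ * ‖Φ u‖ ^ 2 ≤ I x + μ * ‖Φ x‖ ^ 2)
    (hΦnc : ∃ a b, Φ a ≠ Φ b) :
    (∀ N : Set (Set X), (∀ A ∈ N, A.Nonempty) → ⋃₀ N = univ →
      (∀ A₁ ∈ N, ∀ A₂ ∈ N, ∃ A₃ ∈ N, A₁ ∪ A₂ ⊆ A₃) →
      ∃ A ∈ N,
        (⨆ l : Y, ⨅ x : A, ((I x + μ * (2 * ⟪Φ x, l⟫ - ‖l‖ ^ 2) : ℝ) : EReal)) <
        ⨅ x : A, ⨆ l : Φ '' A, ((I x + μ * (2 * ⟪Φ x, l⟫ - ‖(l : Y)‖ ^ 2) : ℝ) : EReal)) ∨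
    (∀ u, (∀ x, I u + μ * ‖Φ u‖ ^ 2 ≤ I x + μ * ‖Φ x‖ ^ 2) →
      ∀ x, I u ≤ I x + 2 * μ * (⟪Φ x, Φ u⟫ - ‖Φ u‖ ^ 2)) := by
  refine or_iff_not_imp_right.2 fun hb N _ hcover hdir ↦ ?_
  push Not at hb
  obtain ⟨u, hu, x₀, hx₀⟩ := hb
  obtain ⟨A₁, hA₁, huA₁⟩ : u ∈ ⋃₀ N := hcover ▸ mem_univ u
  obtain ⟨A₂, hA₂, hxA₂⟩ : x₀ ∈ ⋃₀ N := hcover ▸ mem_univ x₀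
  obtain ⟨A, hA, hsub⟩ := hdir A₁ hA₁ A₂ hA₂
  have huA : u ∈ A := hsub (Or.inl huA₁)
  have hxA : x₀ ∈ A := hsub (Or.inr hxA₂)
  obtain ⟨c, hc, hbound⟩ := exists_lt_forall_le_or_le (m := I u + μ * ‖Φ u‖ ^ 2) (v := Φ u)
    (g := fun l ↦ I x₀ + μ * (2 * ⟪Φ x₀, l⟫ - ‖l‖ ^ 2)) hμ
    (Continuous.continuousAt (by fun_prop)) (by linarith)
  refine ⟨A, hA, lt_of_le_of_lt (b := (c : EReal)) (iSup_le fun l ↦ ?_)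
    (lt_of_lt_of_le (EReal.coe_lt_coe_iff.2 hc) (le_iInf fun x ↦ ?_))⟩
  · rcases hbound l with h | h
    · refine (iInf_le _ ⟨u, huA⟩).trans (EReal.coe_le_coe_iff.2 (le_trans (le_of_eq ?_) h))
      rw [norm_sub_sq_real]
      ring
    · exact (iInf_le _ ⟨x₀, hxA⟩).trans (EReal.coe_le_coe_iff.2 h)
  · refine le_iSup_of_le ⟨Φ x, mem_image_of_mem Φ x.2⟩
      (EReal.coe_le_coe_iff.2 ((hu x).trans (le_of_eq ?_)))
    rw [real_inner_self_eq_norm_sq]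
    ring
end

section
/- Let X be a nonempty set, Y a real inner product space, I : X → ℝ and Φ : X → Y a nonconstant map such that (i) sup_X I < +∞ and (ii) inf_{z∈Φ(X)} ⟨z,y⟩ = −∞ for all y ∈ Φ(X)∖{0}. Then for each μ > 0 at least one of the following holds: (a) for each filtering cover N of X there exists A ∈ N such that sup_{λ∈Y} inf_{x∈A} (I(x) + μ(2⟨Φ(x),λ⟩ − ‖λ‖²)) < inf_{x∈A} sup_{λ∈Φ(A)} (I(x) + μ(2⟨Φ(x),λ⟩ − ‖λ‖²)); (b) every global minimum of the function x ↦ I(x) + μ‖Φ(x)‖² belongs to Φ⁻¹(0). -/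
open Set Filter Topology RealInnerProductSpace

/-- If `u` and `x` lie in `A`, `u` minimizes `I + μ‖Φ‖²`, and the minimax inequality is an equality
on `A`, then the Lagrangian at `(x, Φ u)` is at least the minimal value. -/
theorem le_lagrangian_of_minimax {X Y : Type*}
    [NormedAddCommGroup Y] [InnerProductSpace ℝ Y] (I : X → ℝ) (Φ : X → Y) {μ : ℝ} (hμ : 0 < μ)
    {u x : X} (hu : ∀ x, I u + μ * ‖Φ u‖ ^ 2 ≤ I x + μ * ‖Φ x‖ ^ 2) {A : Set X}
    (huA : u ∈ A) (hxA : x ∈ A)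
    (hA : (⨅ x : A, ⨆ l : Φ '' A, ((I x + μ * (2 * ⟪Φ x, l⟫ - ‖(l : Y)‖ ^ 2) : ℝ) : EReal)) ≤
      ⨆ l : Y, ⨅ x : A, ((I x + μ * (2 * ⟪Φ x, l⟫ - ‖l‖ ^ 2) : ℝ) : EReal)) :
    I u + μ * ‖Φ u‖ ^ 2 ≤ I x + μ * (2 * ⟪Φ x, Φ u⟫ - ‖Φ u‖ ^ 2) := by
  set m := I u + μ * ‖Φ u‖ ^ 2 with hm
  have hinf : (m : EReal) ≤
      ⨅ x : A, ⨆ l : Φ '' A, ((I x + μ * (2 * ⟪Φ x, l⟫ - ‖(l : Y)‖ ^ 2) : ℝ) : EReal) := by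
    refine le_iInf fun z => le_iSup_of_le ⟨Φ z, mem_image_of_mem Φ z.2⟩ ?_
    rw [EReal.coe_le_coe_iff, real_inner_self_eq_norm_sq]
    linarith [hu z]
  by_contra! hlt
  obtain ⟨c, hxc, hcm⟩ := exists_between hlt
  have hcont : Continuous fun l : Y => I x + μ * (2 * ⟪Φ x, l⟫ - ‖l‖ ^ 2) := by fun_prop
  obtain ⟨δ, hδ, hball⟩ := Metric.eventually_nhds_iff.1
    (hcont.continuousAt.eventually_lt_const hxc)
  have hlow : ((max c (m - μ * δ ^ 2) : ℝ) : EReal) < m := by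
    rw [EReal.coe_lt_coe_iff]
    exact max_lt hcm (sub_lt_self m (by positivity))
  obtain ⟨l, hl⟩ := lt_iSup_iff.1 (hlow.trans_le (hinf.trans hA))
  have hlx := EReal.coe_lt_coe_iff.1 (hl.trans_le (iInf_le _ ⟨x, hxA⟩))
  have hlu := EReal.coe_lt_coe_iff.1 (hl.trans_le (iInf_le _ ⟨u, huA⟩))
  have hdist : dist l (Φ u) < δ := by
    rw [dist_comm, dist_eq_norm]
    refine lt_of_pow_lt_pow_left₀ 2 hδ.le (lt_of_mul_lt_mul_left ?_ hμ.le)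
    rw [norm_sub_sq_real]
    linarith [(le_max_right _ _).trans_lt hlu]
  exact lt_asymm (hball hdist) ((le_max_left _ _).trans_lt hlx)

theorem stmt4 {X Y : Type*} [Nonempty X]
    [NormedAddCommGroup Y] [InnerProductSpace ℝ Y]
    (I : X → ℝ) (Φ : X → Y)
    (hΦnc : ∃ a b, Φ a ≠ Φ b)
    (hIbdd : BddAbove (Set.range I))
    (hΦ : ∀ y ∈ Set.range Φ, y ≠ 0 → ∀ c : ℝ, ∃ x, ⟪Φ x, y⟫ < c)
    (μ : ℝ) (hμ : 0 < μ) :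
    (∀ N : Set (Set X), (∀ A ∈ N, A.Nonempty) → ⋃₀ N = univ →
      (∀ A₁ ∈ N, ∀ A₂ ∈ N, ∃ A₃ ∈ N, A₁ ∪ A₂ ⊆ A₃) →
      ∃ A ∈ N,
        (⨆ l : Y, ⨅ x : A, ((I x + μ * (2 * ⟪Φ x, l⟫ - ‖l‖ ^ 2) : ℝ) : EReal)) <
        ⨅ x : A, ⨆ l : Φ '' A, ((I x + μ * (2 * ⟪Φ x, l⟫ - ‖(l : Y)‖ ^ 2) : ℝ) : EReal)) ∨
    (∀ u, (∀ x, I u + μ * ‖Φ u‖ ^ 2 ≤ I x + μ * ‖Φ x‖ ^ 2) → Φ u = 0) := by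
  refine or_iff_not_imp_left.2 fun hN u hu => ?_
  push Not at hN
  obtain ⟨N, -, hcov, hdir, hN⟩ := hN
  by_contra hne
  obtain ⟨M, hM⟩ := hIbdd
  obtain ⟨x, hx⟩ := hΦ (Φ u) (mem_range_self u) hne ((I u + 2 * μ * ‖Φ u‖ ^ 2 - M) / (2 * μ))
  obtain ⟨A₁, hA₁, hu₁⟩ := mem_sUnion.1 (hcov ▸ mem_univ u)
  obtain ⟨A₂, hA₂, hx₂⟩ := mem_sUnion.1 (hcov ▸ mem_univ x)
  obtain ⟨A, hA, hsub⟩ := hdir A₁ hA₁ A₂ hA₂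
  have hle := le_lagrangian_of_minimax I Φ hμ hu (hsub (Or.inl hu₁)) (hsub (Or.inr hx₂)) (hN A hA)
  rw [lt_div_iff₀ (by positivity)] at hx
  linarith [hM (mem_range_self x)]
end

section
/- Let X be a nonempty set, I, Φ : X → ℝ with Φ not constant, and μ > 0 such that the function I − μΦ has a global minimum. Then at least one of the following holds: (a) for each filtering cover N of X there exists A ∈ N such that sup_{λ∈ℝ} inf_{x∈A} (I(x) − μ(e^{Φ(x)−λ} + λ)) < inf_{x∈A} sup_{λ∈Φ(A)} (I(x) − μ(e^{Φ(x)−λ} + λ)); (b) for each global minimum u of I − μΦ one has I(u) ≤ I(x) − μ(e^{Φ(x)−Φ(u)} − 1) for all x ∈ X. -/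
open Set Filter Topology Real

/-- A quantitative form of `s + 1 < exp s` away from `s = 0`. -/
theorem min_one_sq_div_four_le_exp_sub (s : ℝ) :
    min 1 (s ^ 2 / 4) ≤ Real.exp s - s - 1 := by
  rcases le_or_gt (-2) s with h | h
  · refine (min_le_right _ _).trans ?_
    have h1 := Real.add_one_le_exp (s / 2)
    have h2 : Real.exp s = Real.exp (s / 2) ^ 2 := by
      rw [sq, ← Real.exp_add, add_halves]
    nlinarith
  · refine (min_le_left _ _).trans ?_
    linarith [Real.exp_pos s]

/-- If the curve `l ↦ b - μ (exp (q - l) + l)` lies strictly below the maximum of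
`l ↦ a - μ (exp (p - l) + l)` at its maximizer `l = p`, then the pointwise minimum of both curves
is bounded away from that maximum. -/
theorem exists_lt_forall_min_sub_mul_exp_le {μ a b p q : ℝ} (hμ : 0 < μ)
    (h : b - μ * (Real.exp (q - p) + p) < a - μ * (1 + p)) :
    ∃ c < a - μ * (1 + p), ∀ l : ℝ,
      min (a - μ * (Real.exp (p - l) + l)) (b - μ * (Real.exp (q - l) + l)) ≤ c := by
  obtain ⟨c, hc, hc'⟩ := exists_between h
  have hcont : Continuous fun l : ℝ ↦ b - μ * (Real.exp (q - l) + l) := by fun_prop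
  obtain ⟨δ, hδ, hball⟩ :=
    Metric.eventually_nhds_iff.1 (hcont.continuousAt.eventually (Iio_mem_nhds hc))
  have hε : 0 < μ * min 1 (δ ^ 2 / 4) := by positivity
  refine ⟨max c (a - μ * (1 + p) - μ * min 1 (δ ^ 2 / 4)), max_lt hc' (by linarith), fun l ↦ ?_⟩
  rcases lt_or_ge (dist l p) δ with hl | hl
  · exact (min_le_right _ _).trans ((hball hl).le.trans (le_max_left _ _))
  · refine (min_le_left _ _).trans (le_trans ?_ (le_max_right _ _))
    have hsq : δ ^ 2 ≤ (p - l) ^ 2 := by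
      rw [← sq_abs (p - l), abs_sub_comm, ← Real.dist_eq]
      gcongr
    have hmono : min 1 (δ ^ 2 / 4) ≤ min 1 ((p - l) ^ 2 / 4) := by gcongr
    have := mul_le_mul_of_nonneg_left
      (hmono.trans (min_one_sq_div_four_le_exp_sub (p - l))) hμ.le
    linarith

theorem stmt5 {X : Type*} [Nonempty X]
    (I Φ : X → ℝ) (hΦnc : ∃ a b, Φ a ≠ Φ b)
    (μ : ℝ) (hμ : 0 < μ)
    (hmin : ∃ u, ∀ x, I u - μ * Φ u ≤ I x - μ * Φ x) :
    (∀ N : Set (Set X), (∀ A ∈ N, A.Nonempty) → ⋃₀ N = univ →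
      (∀ A₁ ∈ N, ∀ A₂ ∈ N, ∃ A₃ ∈ N, A₁ ∪ A₂ ⊆ A₃) →
      ∃ A ∈ N,
        (⨆ l : ℝ, ⨅ x : A, ((I x - μ * (Real.exp (Φ x - l) + l) : ℝ) : EReal)) <
        ⨅ x : A, ⨆ l : Φ '' A, ((I x - μ * (Real.exp (Φ x - l) + l) : ℝ) : EReal)) ∨
    (∀ u, (∀ x, I u - μ * Φ u ≤ I x - μ * Φ x) →
      ∀ x, I u ≤ I x - μ * (Real.exp (Φ x - Φ u) - 1)) := by
  refine or_iff_not_imp_right.2 fun hb N _ hcover hdir ↦ ?_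
  push Not at hb
  obtain ⟨u, hu, x, hx⟩ := hb
  obtain ⟨A₁, hA₁, hu₁⟩ : u ∈ ⋃₀ N := hcover ▸ mem_univ u
  obtain ⟨A₂, hA₂, hx₂⟩ : x ∈ ⋃₀ N := hcover ▸ mem_univ x
  obtain ⟨A, hA, hsub⟩ := hdir A₁ hA₁ A₂ hA₂
  have huA : u ∈ A := hsub (Or.inl hu₁)
  have hxA : x ∈ A := hsub (Or.inr hx₂)
  obtain ⟨c, hc, hle⟩ := exists_lt_forall_min_sub_mul_exp_le (a := I u) (b := I x)
    (p := Φ u) (q := Φ x) hμ (by linarith)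
  refine ⟨A, hA, lt_of_le_of_lt (b := (c : EReal)) (iSup_le fun l ↦ ?_)
    (lt_of_lt_of_le (EReal.coe_lt_coe_iff.2 hc) (le_iInf fun y ↦ ?_))⟩
  · rcases min_le_iff.1 (hle l) with h | h
    · exact (iInf_le _ (⟨u, huA⟩ : A)).trans (EReal.coe_le_coe_iff.2 h)
    · exact (iInf_le _ (⟨x, hxA⟩ : A)).trans (EReal.coe_le_coe_iff.2 h)
  · refine le_trans (EReal.coe_le_coe_iff.2 ?_)
      (le_iSup (fun l : Φ '' A ↦ ((I y - μ * (Real.exp (Φ y - l) + l) : ℝ) : EReal))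
        ⟨Φ y, mem_image_of_mem Φ y.2⟩)
    rw [sub_self, Real.exp_zero]
    linarith [hu y]
end

section
/- Let Y be a real normed space and let X ⊆ Y be a nonempty compact set which is uniquely remotal with respect to conv(X), the convex hull of X. Then X is a singleton. -/
open Set

theorem norm_sub_le_sSup_of_isCompact {Y : Type*} [NormedAddCommGroup Y] {X : Set Y}
    (hX : IsCompact X) (y : Y) {x : Y} (hx : x ∈ X) :
    ‖x - y‖ ≤ sSup ((fun u => ‖u - y‖) '' X) :=
  le_csSup (hX.image (by fun_prop)).bddAbove (mem_image_of_mem _ hx)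

/-- Away from its unique maximizer, the distance to `y` on a compact set is bounded by a constant
strictly below the maximum. -/
theorem exists_lt_forall_norm_sub_le {Y : Type*} [NormedAddCommGroup Y] {X : Set Y}
    (hX : IsCompact X) {y q : Y} {r ε : ℝ} (hε : 0 < ε) (hle : ∀ x ∈ X, ‖x - y‖ ≤ r)
    (huniq : ∀ x ∈ X, ‖x - y‖ = r → x = q) :
    ∃ m < r, ∀ x ∈ X, ε ≤ ‖x - q‖ → ‖x - y‖ ≤ m := by
  have hK : IsCompact (X ∩ {x | ε ≤ ‖x - q‖}) :=
    hX.inter_right (isClosed_le continuous_const (by fun_prop))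
  rcases (X ∩ {x | ε ≤ ‖x - q‖}).eq_empty_or_nonempty with h | h
  · exact ⟨r - 1, by linarith, fun x hx hxq => (eq_empty_iff_forall_notMem.1 h x ⟨hx, hxq⟩).elim⟩
  · obtain ⟨z, ⟨hzX, hzq⟩, hz⟩ :=
      hK.exists_isMaxOn (f := fun x => ‖x - y‖) h (by fun_prop)
    refine ⟨‖z - y‖, lt_of_le_of_ne (hle z hzX) fun heq => ?_, fun x hx hxq => hz ⟨hx, hxq⟩⟩
    have hzq' : ε ≤ ‖z - q‖ := hzq
    rw [huniq z hzX heq, sub_self, norm_zero] at hzq'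
    linarith

theorem norm_sub_add_smul_le {Y : Type*} [NormedAddCommGroup Y] [NormedSpace ℝ Y]
    (x y p : Y) {t : ℝ} (ht0 : 0 ≤ t) (ht1 : t ≤ 1) :
    ‖x - (y + t • (p - y))‖ ≤ (1 - t) * ‖x - y‖ + t * ‖x - p‖ := by
  have h : x - (y + t • (p - y)) = (1 - t) • (x - y) + t • (x - p) := by module
  rw [h]
  refine (norm_add_le _ _).trans_eq ?_
  rw [norm_smul, norm_smul, Real.norm_of_nonneg ht0, Real.norm_of_nonneg (sub_nonneg.2 ht1)]

/-- If the farthest point of a compact set from `y` is unique, then moving `y` slightly towards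
a point close to that farthest point strictly decreases all distances below the old maximum. -/
theorem exists_forall_norm_sub_add_smul_lt {Y : Type*} [NormedAddCommGroup Y] [NormedSpace ℝ Y]
    {X : Set Y} (hX : IsCompact X) {y q p : Y} {r ε : ℝ} (hε : 0 < ε) (hr : 2 * ε < r)
    (hle : ∀ x ∈ X, ‖x - y‖ ≤ r) (huniq : ∀ x ∈ X, ‖x - y‖ = r → x = q) (hqp : ‖q - p‖ < ε) :
    ∃ t ∈ Icc (0 : ℝ) 1, ∀ x ∈ X, ‖x - (y + t • (p - y))‖ < r := by
  obtain ⟨m, hm, hfar⟩ := exists_lt_forall_norm_sub_le hX hε hle huniq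
  have hs : 0 < r - m := sub_pos.2 hm
  have hD : 0 ≤ ‖p - y‖ := norm_nonneg _
  have hden : 0 < r - m + ‖p - y‖ + 1 := by positivity
  set t := (r - m) / (r - m + ‖p - y‖ + 1) with ht
  have ht0 : 0 < t := by positivity
  have ht1 : t < 1 := by rw [ht, div_lt_one hden]; linarith
  have htD : t * ‖p - y‖ < r - m := by
    rw [ht, div_mul_eq_mul_div, div_lt_iff₀ hden]
    nlinarith
  refine ⟨t, ⟨ht0.le, ht1.le⟩, fun x hx => ?_⟩
  rcases le_or_gt ε ‖x - q‖ with h | h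
  · have h1 : ‖x - (y + t • (p - y))‖ ≤ ‖x - y‖ + t * ‖p - y‖ := by
      rw [← sub_sub]
      refine (norm_sub_le _ _).trans_eq ?_
      rw [norm_smul, Real.norm_of_nonneg ht0.le]
    linarith [hfar x hx h]
  · have h1 := norm_sub_add_smul_le x y p ht0.le ht1.le
    have h2 : ‖x - p‖ ≤ ‖x - q‖ + ‖q - p‖ := norm_sub_le_norm_sub_add_norm_sub x q p
    have h3 := hle x hx
    nlinarith

theorem stmt6 {Y : Type*} [NormedAddCommGroup Y] [NormedSpace ℝ Y]
    (X : Set Y) (hXne : X.Nonempty) (hXcpt : IsCompact X)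
    (hrem : ∀ y ∈ convexHull ℝ X,
      ∃! x, x ∈ X ∧ ‖x - y‖ = sSup ((fun u => ‖u - y‖) '' X)) :
    ∃ a, X = {a} := by
  refine exists_eq_singleton_iff_nonempty_subsingleton.2 ⟨hXne, fun a ha b hb => ?_⟩
  by_contra hab
  set r : Y → ℝ := fun y => sSup ((fun u => ‖u - y‖) '' X)
  have hle : ∀ y, ∀ x ∈ X, ‖x - y‖ ≤ r y := fun y x hx => norm_sub_le_sSup_of_isCompact hXcpt y hx
  have hcont : Continuous r := hXcpt.continuous_sSup (f := fun y u => ‖u - y‖) (by fun_prop)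
  have hpos : 0 < ‖a - b‖ := norm_pos_iff.2 (sub_ne_zero.2 hab)
  obtain ⟨ε, hε, hεab⟩ : ∃ ε > 0, 4 * ε < ‖a - b‖ := ⟨‖a - b‖ / 5, by positivity, by linarith⟩
  have hlarge : ∀ y, 2 * ε < r y := fun y => by
    have h := norm_sub_le_norm_sub_add_norm_sub a y b
    rw [norm_sub_rev y b] at h
    linarith [hle y a ha, hle y b hb]
  obtain ⟨F, hFX, hFfin, hF⟩ := hXcpt.finite_cover_balls hε
  have hFne : F.Nonempty := by
    obtain ⟨p, hp, -⟩ := mem_iUnion₂.1 (hF ha)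
    exact ⟨p, hp⟩
  obtain ⟨y, hyF, hymin⟩ := (hFfin.isCompact_convexHull (𝕜 := ℝ)).exists_isMinOn
    hFne.convexHull hcont.continuousOn
  have hsub : convexHull ℝ F ⊆ convexHull ℝ X := convexHull_mono hFX
  obtain ⟨q, ⟨hqX, -⟩, huniq⟩ := hrem y (hsub hyF)
  obtain ⟨p, hpF, hqp⟩ := mem_iUnion₂.1 (hF hqX)
  obtain ⟨t, ht, hlt⟩ := exists_forall_norm_sub_add_smul_lt hXcpt hε (hlarge y) (hle y)
    (fun x hx h => huniq x ⟨hx, h⟩) (mem_ball_iff_norm.1 hqp)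
  have hzF : y + t • (p - y) ∈ convexHull ℝ F :=
    (convex_convexHull ℝ F).add_smul_sub_mem hyF (subset_convexHull ℝ F hpF) ht
  obtain ⟨x, ⟨hxX, hx⟩, -⟩ := hrem _ (hsub hzF)
  have h1 : r y ≤ r (y + t • (p - y)) := hymin hzF
  exact absurd (hlt x hxX) (not_lt.2 (h1.trans_eq hx.symm))
end

section
/- Let Y be a finite-dimensional real Hilbert space, J : Y → ℝ a C¹ function with locally Lipschitzian derivative, and φ : Y → [0,+∞) a C¹ convex function whose derivative is locally Lipschitzian at 0 and with φ⁻¹(0) = {0}. Then for each x₀ ∈ Y with J'(x₀) ≠ 0 there exists δ > 0 such that, for each r ∈ (0,δ), the restriction of J to the closed ball B(x₀,r) has a unique global minimum u_r, and u_r satisfies J(u_r) ≤ J(x) − φ(x − u_r) for all x ∈ B(x₀,r). -/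
open Set Filter Topology Metric

/-- The quadratic Taylor bound for a function with Lipschitz derivative on a convex set. -/
theorem Convex.abs_sub_sub_fderiv_le_of_lipschitzOnWith {E : Type*} [NormedAddCommGroup E]
    [NormedSpace ℝ E] {f : E → ℝ} (hf : Differentiable ℝ f) {s : Set E} (hs : Convex ℝ s)
    {K : NNReal} (hK : LipschitzOnWith K (fderiv ℝ f) s) {x y : E} (hx : x ∈ s) (hy : y ∈ s) :
    |f y - f x - fderiv ℝ f x (y - x)| ≤ K * ‖y - x‖ ^ 2 := by
  have hseg : segment ℝ x y ⊆ s := hs.segment_subset hx hy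
  have h := (convex_segment x y).norm_image_sub_le_of_norm_hasFDerivWithin_le'
    (f := f) (f' := fderiv ℝ f) (φ := fderiv ℝ f x) (C := K * ‖y - x‖)
    (fun z _ => (hf z).hasFDerivAt.hasFDerivWithinAt)
    (fun z hz => by
      refine (hK.norm_sub_le (hseg hz) hx).trans ?_
      gcongr
      exact norm_sub_le_of_mem_segment hz)
    (left_mem_segment ℝ x y) (right_mem_segment ℝ x y)
  rw [Real.norm_eq_abs] at h
  linarith [h, sq ‖y - x‖]

/-- A functional whose minimum over a ball is attained at `u` satisfies, on this ball,
the growth inequality coming from the curvature of the sphere. -/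
theorem norm_mul_norm_sub_sq_le_of_forall_nonneg {E : Type*} [NormedAddCommGroup E]
    [InnerProductSpace ℝ E] [CompleteSpace E] {L : E →L[ℝ] ℝ} (hL : L ≠ 0) {x₀ u : E} {r : ℝ}
    (hr : 0 < r) (hu : u ∈ closedBall x₀ r) (h : ∀ x ∈ closedBall x₀ r, 0 ≤ L (x - u))
    {x : E} (hx : x ∈ closedBall x₀ r) :
    ‖L‖ * ‖x - u‖ ^ 2 ≤ 2 * r * L (x - u) := by
  obtain ⟨g, rfl⟩ := (InnerProductSpace.toDual ℝ E).surjective L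
  simp only [InnerProductSpace.toDual_apply_apply, LinearIsometryEquiv.norm_map,
    mem_closedBall, dist_eq_norm] at *
  have hg : 0 < ‖g‖ := by
    rw [norm_pos_iff]
    rintro rfl
    exact hL (map_zero _)
  have hw : ‖x₀ - u‖ ≤ r := by rwa [norm_sub_rev]
  have h1 : r * ‖g‖ ≤ inner ℝ g (x₀ - u) := by
    have := h (x₀ - (r / ‖g‖) • g) (by
      rw [sub_sub_cancel_left, norm_neg, norm_smul, Real.norm_of_nonneg (by positivity)]
      field_simp
      rfl)
    rw [sub_right_comm, inner_sub_right, inner_smul_right, real_inner_self_eq_norm_sq] at this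
    have e : r / ‖g‖ * ‖g‖ ^ 2 = r * ‖g‖ := by field_simp
    linarith
  have h2 : r • g = ‖g‖ • (x₀ - u) := by
    rw [← sub_eq_zero, ← norm_eq_zero, ← sq_eq_zero_iff]
    refine le_antisymm ?_ (sq_nonneg _)
    rw [norm_sub_sq_real, norm_smul, norm_smul, inner_smul_left, inner_smul_right,
      norm_norm, Real.norm_of_nonneg hr.le]
    simp only [conj_trivial]
    have h3 : ‖x₀ - u‖ ^ 2 ≤ r ^ 2 := by gcongr
    nlinarith [mul_le_mul_of_nonneg_left h1 (mul_pos hr hg).le,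
      mul_le_mul_of_nonneg_left h3 (sq_nonneg ‖g‖)]
  have h3 : ‖x₀ - u‖ = r := by
    have := congrArg norm h2
    rw [norm_smul, norm_smul, norm_norm, Real.norm_of_nonneg hr.le, mul_comm] at this
    exact (mul_left_cancel₀ hg.ne' this).symm
  have h4 : r * inner ℝ g (x - u) = ‖g‖ * inner ℝ (x₀ - u) (x - u) := by
    have := congrArg (fun z => inner ℝ z (x - u)) h2
    simpa [inner_smul_left] using this
  have h5 : ‖x - x₀‖ ^ 2 = ‖x - u‖ ^ 2 - 2 * inner ℝ (x₀ - u) (x - u) + ‖x₀ - u‖ ^ 2 := by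
    rw [← sub_sub_sub_cancel_right x x₀ u, norm_sub_sq_real, real_inner_comm]
  have h6 : ‖x - x₀‖ ^ 2 ≤ r ^ 2 := by gcongr
  rw [h3] at h5
  nlinarith

theorem stmt8 {Y : Type*} [NormedAddCommGroup Y] [InnerProductSpace ℝ Y]
    [FiniteDimensional ℝ Y]
    (J : Y → ℝ) (hJ : ContDiff ℝ 1 J)
    (hJ' : ∀ x : Y, ∃ s ∈ 𝓝 x, ∃ K : NNReal, LipschitzOnWith K (fderiv ℝ J) s)
    (φ : Y → ℝ) (hφ0 : ∀ y, 0 ≤ φ y) (hφC1 : ContDiff ℝ 1 φ)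
    (hφconv : ConvexOn ℝ univ φ)
    (hφ' : ∃ s ∈ 𝓝 (0 : Y), ∃ K : NNReal, LipschitzOnWith K (fderiv ℝ φ) s)
    (hφz : ∀ y, φ y = 0 ↔ y = 0) :
    ∀ x₀ : Y, fderiv ℝ J x₀ ≠ 0 →
      ∃ δ > 0, ∀ r : ℝ, 0 < r → r < δ →
        ∃ u ∈ closedBall x₀ r,
          (∀ x ∈ closedBall x₀ r, J u ≤ J x) ∧
          (∀ v ∈ closedBall x₀ r, (∀ x ∈ closedBall x₀ r, J v ≤ J x) → v = u) ∧
          (∀ x ∈ closedBall x₀ r, J u ≤ J x - φ (x - u)) := by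
  intro x₀ hx₀
  have : CompleteSpace Y := FiniteDimensional.complete ℝ Y
  have hJd : Differentiable ℝ J := hJ.differentiable one_ne_zero
  have hφd : Differentiable ℝ φ := hφC1.differentiable one_ne_zero
  obtain ⟨s, hs, K, hK⟩ := hJ' x₀
  obtain ⟨t, ht, M, hM⟩ := hφ'
  have hm : 0 < ‖fderiv ℝ J x₀‖ := norm_pos_iff.2 hx₀
  have hcont : ∀ᶠ x in 𝓝 x₀, ‖fderiv ℝ J x₀‖ / 2 < ‖fderiv ℝ J x‖ :=
    (hJ.continuous_fderiv one_ne_zero).norm.continuousAt.eventually (lt_mem_nhds (half_lt_self hm))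
  obtain ⟨ε₁, hε₁, h₁⟩ := Metric.mem_nhds_iff.1 (Filter.inter_mem hs hcont)
  obtain ⟨ε₂, hε₂, h₂⟩ := Metric.mem_nhds_iff.1 ht
  have hφle : ∀ z ∈ ball (0 : Y) ε₂, φ z ≤ M * ‖z‖ ^ 2 := by
    intro z hz
    have hφ00 : φ 0 = 0 := (hφz 0).2 rfl
    have hmin : IsLocalMin φ 0 := Eventually.of_forall fun y => by simpa [hφ00] using hφ0 y
    have := (convex_ball (0 : Y) ε₂).abs_sub_sub_fderiv_le_of_lipschitzOnWith hφd (hM.mono h₂)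
      (mem_ball_self hε₂) hz
    rw [hmin.fderiv_eq_zero, hφ00] at this
    simpa using (le_abs_self _).trans this
  refine ⟨min ε₁ (min (ε₂ / 2) (‖fderiv ℝ J x₀‖ / (4 * (K + M + 1)))), by positivity, ?_⟩
  intro r hr hrδ
  obtain ⟨hr₁, hr₂, hr₃⟩ : r < ε₁ ∧ r < ε₂ / 2 ∧ r < ‖fderiv ℝ J x₀‖ / (4 * (K + M + 1)) := by
    simpa using hrδ
  rw [lt_div_iff₀ (by positivity)] at hr₃
  have hsub : closedBall x₀ r ⊆ ball x₀ ε₁ := closedBall_subset_ball hr₁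
  obtain ⟨u, hu, humin⟩ := (isCompact_closedBall x₀ r).exists_isMinOn
    ⟨x₀, mem_closedBall_self hr.le⟩ hJ.continuous.continuousOn
  have key : ∀ x ∈ closedBall x₀ r, J u ≤ J x - φ (x - u) := by
    intro x hx
    have hgu : ‖fderiv ℝ J x₀‖ / 2 < ‖fderiv ℝ J u‖ := (h₁ (hsub hu)).2
    have hvar : ∀ y ∈ closedBall x₀ r, 0 ≤ fderiv ℝ J u (y - u) := fun y hy =>
      humin.localize.hasFDerivWithinAt_nonneg (hJd u).hasFDerivAt.hasFDerivWithinAt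
        (sub_mem_posTangentConeAt_of_segment_subset
          ((convex_closedBall x₀ r).segment_subset hu hy))
    have hgrow := norm_mul_norm_sub_sq_le_of_forall_nonneg
      (norm_pos_iff.1 ((half_pos hm).trans hgu)) hr hu hvar hx
    have htay := (abs_le.1 ((convex_ball x₀ ε₁).abs_sub_sub_fderiv_le_of_lipschitzOnWith hJd
      (hK.mono fun y hy => (h₁ hy).1) (hsub hu) (hsub hx))).1
    have hφx := hφle (x - u) (by
      rw [mem_ball_zero_iff, ← dist_eq_norm]
      linarith [dist_triangle_right x u x₀, mem_closedBall.1 hx, mem_closedBall.1 hu])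
    have hlow : (K + M) * ‖x - u‖ ^ 2 ≤ fderiv ℝ J u (x - u) := by
      refine le_of_mul_le_mul_left ?_ (by positivity : 0 < 2 * r)
      refine le_trans ?_ hgrow
      rw [← mul_assoc]
      gcongr
      linarith
    linarith
  refine ⟨u, hu, humin, fun v hv hvmin => ?_, key⟩
  have hφv : φ (v - u) ≤ 0 := by linarith [key v hv, hvmin u hu]
  exact sub_eq_zero.1 ((hφz _).1 (hφv.antisymm (hφ0 _)))
end

section
/- Let X be a convex subset of a real vector space, (Y,⟨·,·⟩) a real inner product space, I : X → ℝ a bounded above convex function, and Φ : X → Y an affine operator such that inf_{z∈Φ(X)} ⟨z,y⟩ = −∞ for all y ∈ Φ(X)∖{0}. Then every global minimum of the function x ↦ I(x) + ‖Φ(x)‖² belongs to Φ⁻¹(0). -/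
open Set RealInnerProductSpace

theorem stmt9 {E Y : Type*} [AddCommGroup E] [Module ℝ E]
    [NormedAddCommGroup Y] [InnerProductSpace ℝ Y]
    (X : Set E) (hX : Convex ℝ X)
    (I : E → ℝ) (hI : ConvexOn ℝ X I) (hIbdd : BddAbove (I '' X))
    (Φ : E → Y)
    (hΦaff : ∀ x ∈ X, ∀ y ∈ X, ∀ t : ℝ, 0 ≤ t → t ≤ 1 →
      Φ (t • x + (1 - t) • y) = t • Φ x + (1 - t) • Φ y)
    (hΦ : ∀ y ∈ Φ '' X, y ≠ 0 → ∀ c : ℝ, ∃ x ∈ X, ⟪Φ x, y⟫ < c) :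
    ∀ u ∈ X, (∀ x ∈ X, I u + ‖Φ u‖ ^ 2 ≤ I x + ‖Φ x‖ ^ 2) → Φ u = 0 := by
  intro u hu hmin
  by_contra hne
  obtain ⟨M, hM⟩ := hIbdd
  obtain ⟨x, hx, hlt⟩ := hΦ (Φ u) ⟨u, hu, rfl⟩ hne ((I u - M + 2 * ‖Φ u‖ ^ 2 - 1) / 2)
  have hIx : I x ≤ M := hM ⟨x, hx, rfl⟩
  set B : ℝ := ‖Φ x - Φ u‖ ^ 2 with hB
  have hB0 : 0 ≤ B := sq_nonneg _
  obtain ⟨t, ht0, ht1, htB⟩ : ∃ t : ℝ, 0 < t ∧ t ≤ 1 ∧ t * B < 1 := by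
    refine ⟨1 / (1 + B), by positivity, ?_, ?_⟩
    · rw [div_le_one (by positivity)]
      linarith
    · rw [div_mul_eq_mul_div, div_lt_one (by positivity)]
      linarith
  have hle := hmin _ (hX hx hu ht0.le (sub_nonneg.2 ht1) (by ring))
  have hconv := hI.2 hx hu ht0.le (sub_nonneg.2 ht1) (by ring)
  simp only [smul_eq_mul] at hconv
  have hseg : t • Φ x + (1 - t) • Φ u = Φ u + t • (Φ x - Φ u) := by module
  have hnorm : ‖Φ u + t • (Φ x - Φ u)‖ ^ 2
      = ‖Φ u‖ ^ 2 + 2 * t * (⟪Φ x, Φ u⟫ - ‖Φ u‖ ^ 2) + t * (t * B) := by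
    rw [norm_add_sq_real, real_inner_smul_right, real_inner_comm, inner_sub_left,
      real_inner_self_eq_norm_sq, norm_smul, mul_pow, Real.norm_eq_abs, sq_abs, hB]
    ring
  rw [hΦaff x hx u hu t ht0.le ht1, hseg, hnorm] at hle
  have hneg : I x - I u + 2 * (⟪Φ x, Φ u⟫ - ‖Φ u‖ ^ 2) + t * B < 0 := by linarith
  have hprod := mul_neg_of_pos_of_neg ht0 hneg
  linarith
end

section
/- Let X be a convex subset of a real vector space, I : X → ℝ a convex function and P : X → (0,+∞) a concave function. Then for each μ > 0, a point u ∈ X is a global minimum of the function x ↦ I(x) − μ·log P(x) if and only if I(u) ≤ I(x) − μ(P(x)/P(u) − 1) for all x ∈ X. -/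
open Set Real

/-- If `μ * log (1 + t * r) ≤ t * d` for all `t ∈ (0, 1]`, then the same inequality holds for the
derivatives at `t = 0`. -/
lemma mul_le_of_forall_mul_log_one_add_le {μ r d : ℝ} (hμ : 0 < μ) (hr : -1 < r)
    (h : ∀ t : ℝ, 0 < t → t ≤ 1 → μ * Real.log (1 + t * r) ≤ t * d) : μ * r ≤ d := by
  have hbound : ∀ t : ℝ, 0 < t → t ≤ 1 → μ * r ≤ d * (1 + t * r) := by
    intro t ht ht1
    have hpos : 0 < 1 + t * r := by nlinarith
    have hlog := Real.one_sub_inv_le_log_of_pos hpos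
    have hle : μ * (1 - (1 + t * r)⁻¹) ≤ t * d :=
      (mul_le_mul_of_nonneg_left hlog hμ.le).trans (h t ht ht1)
    have hmul := mul_le_mul_of_nonneg_right hle hpos.le
    have heq : μ * (1 - (1 + t * r)⁻¹) * (1 + t * r) = t * (μ * r) := by
      field_simp
      ring
    rw [heq, mul_assoc] at hmul
    exact le_of_mul_le_mul_left hmul ht
  have hlim : Filter.Tendsto (fun t : ℝ => d * (1 + t * r)) (nhdsWithin 0 (Ioi 0)) (nhds d) := by
    have hcont : Continuous fun t : ℝ => d * (1 + t * r) := by fun_prop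
    simpa using (hcont.tendsto 0).mono_left nhdsWithin_le_nhds
  refine ge_of_tendsto hlim ?_
  filter_upwards [Ioc_mem_nhdsGT (zero_lt_one' ℝ)] with t ht
  exact hbound t ht.1 ht.2

theorem stmt11 {E : Type*} [AddCommGroup E] [Module ℝ E]
    (X : Set E) (hX : Convex ℝ X)
    (I : E → ℝ) (hI : ConvexOn ℝ X I)
    (P : E → ℝ) (hPpos : ∀ x ∈ X, 0 < P x) (hP : ConcaveOn ℝ X P)
    (μ : ℝ) (hμ : 0 < μ) :
    ∀ u ∈ X,
      ((∀ x ∈ X, I u - μ * Real.log (P u) ≤ I x - μ * Real.log (P x)) ↔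
        (∀ x ∈ X, I u ≤ I x - μ * (P x / P u - 1))) := by
  intro u hu
  have hPu := hPpos u hu
  constructor
  · intro hmin x hx
    have hr : -1 < P x / P u - 1 := by linarith [div_pos (hPpos x hx) hPu]
    suffices μ * (P x / P u - 1) ≤ I x - I u by linarith
    refine mul_le_of_forall_mul_log_one_add_le hμ hr fun t ht ht1 => ?_
    have hs : 0 ≤ 1 - t := by linarith
    have hst : 1 - t + t = 1 := by ring
    have hy := hX hu hx hs ht.le hst
    have hIy := hI.2 hu hx hs ht.le hst
    have hPy := hP.2 hu hx hs ht.le hst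
    have hmin_y := hmin _ hy
    simp only [smul_eq_mul] at hIy hPy
    have hpos : 0 < 1 + t * (P x / P u - 1) := by nlinarith
    have hprod : P u * (1 + t * (P x / P u - 1)) = (1 - t) * P u + t * P x := by
      field_simp
      ring
    have hlog := Real.log_le_log (mul_pos hPu hpos) (hprod.trans_le hPy)
    rw [Real.log_mul hPu.ne' hpos.ne'] at hlog
    linarith [mul_le_mul_of_nonneg_left hlog hμ.le]
  · intro h x hx
    have hlog := Real.log_le_sub_one_of_pos (div_pos (hPpos x hx) hPu)
    rw [Real.log_div (hPpos x hx).ne' hPu.ne'] at hlog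
    linarith [h x hx, mul_le_mul_of_nonneg_left hlog hμ.le]
end

section
/- Let φ ∈ G, Ψ ∈ H and J ∈ M (with respect to X, Λ, Y, y₀). Then for each real number μ > θ(φ,Ψ,J) and each filtering cover N of X, there exists A ∈ N such that for every set D ⊆ Λ with λ_x ∈ D for all x ∈ A, one has sup_{λ∈D} inf_{x∈A} (J(x) − μ·φ(Ψ(x,λ))) < inf_{x∈A} sup_{λ∈D} (J(x) − μ·φ(Ψ(x,λ))). -/
open Set Filter Topology

theorem stmt12 {X Λ Y : Type*} [Nonempty X] [TopologicalSpace Λ]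
    [TopologicalSpace Y] (y₀ : Y)
    (φ : Y → ℝ) (hφ_lsc : LowerSemicontinuous φ) (hφ0 : ∀ y, 0 ≤ φ y)
    (hφz : ∀ y, φ y = 0 ↔ y = y₀)
    (hφV : ∀ V ∈ 𝓝 y₀, ∃ c > 0, ∀ y ∉ V, c ≤ φ y)
    (Ψ : X → Λ → Y)
    (hΨc : ∀ x, Continuous (Ψ x)) (hΨi : ∀ x, Function.Injective (Ψ x))
    (hΨo : ∀ x, IsOpenMap (Ψ x))
    (lam : X → Λ) (hlam : ∀ x, Ψ x (lam x) = y₀)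
    (hlamnc : ∃ x x', lam x ≠ lam x')
    (J : X → ℝ) (hJ : ∃ u, ∀ x, J u ≤ J x)
    (μ : ℝ) (hμ : ricceriTheta φ Ψ lam J < μ)
    (N : Set (Set X)) (hNne : ∀ A ∈ N, A.Nonempty) (hNcov : ⋃₀ N = univ)
    (hNfil : ∀ A₁ ∈ N, ∀ A₂ ∈ N, ∃ A₃ ∈ N, A₁ ∪ A₂ ⊆ A₃) :
    ∃ A ∈ N, ∀ D : Set Λ, (∀ x ∈ A, lam x ∈ D) →
      (⨆ l : D, ⨅ x : A, ((J x - μ * φ (Ψ x l) : ℝ) : EReal)) <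
      ⨅ x : A, ⨆ l : D, ((J x - μ * φ (Ψ x l) : ℝ) : EReal) := by
  obtain ⟨u, x₁, hu, hlt, hμ0⟩ : ∃ u x, (∀ z, J u ≤ J z) ∧
      J x - μ * φ (Ψ x (lam u)) < J u ∧ 0 < μ := by
    have hne : {r : ℝ | ∃ u x, (∀ z, J u ≤ J z) ∧ lam x ≠ lam u ∧
        r = (J x - J u) / φ (Ψ x (lam u))}.Nonempty := by
      obtain ⟨u, hu⟩ := hJ
      obtain ⟨x, hx⟩ : ∃ x, lam x ≠ lam u := by
        by_contra! h
        obtain ⟨x, x', hxx'⟩ := hlamnc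
        exact hxx' ((h x).trans (h x').symm)
      exact ⟨_, u, x, hu, hx, rfl⟩
    obtain ⟨r, ⟨u, x, hu, hx, rfl⟩, hr⟩ := exists_lt_of_csInf_lt hne hμ
    have hpos : 0 < φ (Ψ x (lam u)) := (hφ0 _).lt_of_ne fun h =>
      hx (hΨi x ((hlam x).trans ((hφz _).1 h.symm).symm))
    have hμ0 : 0 < μ := (div_nonneg (sub_nonneg.2 (hu x)) hpos.le).trans_lt hr
    rw [div_lt_iff₀ hpos] at hr
    exact ⟨u, x, hu, by linarith, hμ0⟩
  obtain ⟨A, hAN, huA, hxA⟩ : ∃ A ∈ N, u ∈ A ∧ x₁ ∈ A := by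
    obtain ⟨A₁, h₁, hu₁⟩ := mem_sUnion.1 (hNcov ▸ mem_univ u)
    obtain ⟨A₂, h₂, hx₂⟩ := mem_sUnion.1 (hNcov ▸ mem_univ x₁)
    obtain ⟨A, hA, hsub⟩ := hNfil A₁ h₁ A₂ h₂
    exact ⟨A, hA, hsub (.inl hu₁), hsub (.inr hx₂)⟩
  obtain ⟨c, hc, hcu⟩ := exists_between hlt
  have hU : {l | J x₁ - μ * φ (Ψ x₁ l) < c} ∈ 𝓝 (lam u) := by
    have hφc : (J x₁ - c) / μ < φ (Ψ x₁ (lam u)) := by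
      rw [div_lt_iff₀ hμ0]; linarith
    filter_upwards [(hΨc x₁).continuousAt.eventually (hφ_lsc _ _ hφc)] with l hl
    rw [gt_iff_lt, div_lt_iff₀ hμ0] at hl
    linarith
  have hV : Ψ u '' {l | J x₁ - μ * φ (Ψ x₁ l) < c} ∈ 𝓝 y₀ :=
    hlam u ▸ (hΨo u).image_mem_nhds hU
  obtain ⟨δ, hδ, hφδ⟩ := hφV _ hV
  refine ⟨A, hAN, fun D hD => ?_⟩
  calc (⨆ l : D, ⨅ x : A, ((J x - μ * φ (Ψ x l) : ℝ) : EReal))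
      ≤ ((max c (J u - μ * δ) : ℝ) : EReal) := by
        refine iSup_le fun l => ?_
        by_cases hl : J x₁ - μ * φ (Ψ x₁ l) < c
        · exact (iInf_le _ ⟨x₁, hxA⟩).trans
            (EReal.coe_le_coe_iff.2 (hl.le.trans (le_max_left _ _)))
        · refine (iInf_le _ ⟨u, huA⟩).trans
            (EReal.coe_le_coe_iff.2 (le_trans ?_ (le_max_right _ _)))
          have hδl := hφδ (Ψ u l) fun h => hl ((hΨi u).mem_set_image.1 h)
          exact sub_le_sub_left (mul_le_mul_of_nonneg_left hδl hμ0.le) _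
    _ < (J u : EReal) :=
        EReal.coe_lt_coe_iff.2 (max_lt hcu (sub_lt_self _ (mul_pos hμ0 hδ)))
    _ ≤ ⨅ x : A, ⨆ l : D, ((J x - μ * φ (Ψ x l) : ℝ) : EReal) := by
        refine le_iInf fun x => le_iSup_of_le ⟨lam x, hD x x.2⟩ (EReal.coe_le_coe_iff.2 ?_)
        simpa [hlam, (hφz y₀).2 rfl] using hu x
end

section
/- Let φ ∈ G, Ψ ∈ H and J ∈ M (with respect to X, Λ, Y, y₀), and assume that 0 ≤ θ(φ,Ψ,J) < +∞. Then a point u ∈ X belongs to M_J if and only if u is a global minimum of the function x ↦ J(x) − θ(φ,Ψ,J)·φ(Ψ(x,λ_u)). In particular, if u ∈ M_J then J(u) ≤ J(x) − θ(φ,Ψ,J)·φ(Ψ(x,λ_u)) for all x ∈ X. -/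
open Set Filter Topology

theorem ricceriTheta_mul_le {X Λ Y : Type*} {φ : Y → ℝ} {Ψ : X → Λ → Y}
    {lam : X → Λ} {J : X → ℝ} (hφ0 : ∀ y, 0 ≤ φ y) {u x : X} (hu : ∀ z, J u ≤ J z)
    (hx : lam x ≠ lam u) (hpos : 0 < φ (Ψ x (lam u))) :
    ricceriTheta φ Ψ lam J * φ (Ψ x (lam u)) ≤ J x - J u := by
  rw [← le_div_iff₀ hpos]
  refine csInf_le ⟨0, ?_⟩ ⟨u, x, hu, hx, rfl⟩
  rintro r ⟨v, z, hv, -, rfl⟩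
  exact div_nonneg (sub_nonneg.2 (hv z)) (hφ0 _)

theorem stmt13 {X Λ Y : Type*} [Nonempty X] [TopologicalSpace Λ]
    [TopologicalSpace Y] (y₀ : Y)
    (φ : Y → ℝ) (hφ_lsc : LowerSemicontinuous φ) (hφ0 : ∀ y, 0 ≤ φ y)
    (hφz : ∀ y, φ y = 0 ↔ y = y₀)
    (hφV : ∀ V ∈ 𝓝 y₀, ∃ c > 0, ∀ y ∉ V, c ≤ φ y)
    (Ψ : X → Λ → Y)
    (hΨc : ∀ x, Continuous (Ψ x)) (hΨi : ∀ x, Function.Injective (Ψ x))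
    (hΨo : ∀ x, IsOpenMap (Ψ x))
    (lam : X → Λ) (hlam : ∀ x, Ψ x (lam x) = y₀)
    (hlamnc : ∃ x x', lam x ≠ lam x')
    (J : X → ℝ) (hJ : ∃ u, ∀ x, J u ≤ J x)
    (hθ : 0 ≤ ricceriTheta φ Ψ lam J) :
    ∀ u : X,
      ((∀ x, J u ≤ J x) ↔
        (∀ x, J u - ricceriTheta φ Ψ lam J * φ (Ψ u (lam u)) ≤
              J x - ricceriTheta φ Ψ lam J * φ (Ψ x (lam u)))) ∧
      ((∀ x, J u ≤ J x) →
        ∀ x, J u ≤ J x - ricceriTheta φ Ψ lam J * φ (Ψ x (lam u))) := by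
  intro u
  have hzero : ∀ x, lam x = lam u → φ (Ψ x (lam u)) = 0 := fun x hx =>
    (hφz _).2 (hx ▸ hlam x)
  have hmin : (∀ x, J u ≤ J x) →
      ∀ x, J u ≤ J x - ricceriTheta φ Ψ lam J * φ (Ψ x (lam u)) := by
    intro hu x
    by_cases hx : lam x = lam u
    · simpa [hzero x hx] using hu x
    · have hpos : 0 < φ (Ψ x (lam u)) := by
        refine (hφ0 _).lt_of_ne' fun h => hx ?_
        exact hΨi x ((hlam x).trans ((hφz _).1 h).symm)
      linarith [ricceriTheta_mul_le hφ0 hu hx hpos]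
  refine ⟨?_, hmin⟩
  rw [hzero u rfl, mul_zero, sub_zero]
  exact ⟨hmin, fun h x => (h x).trans (sub_le_self _ (mul_nonneg hθ (hφ0 _)))⟩
end

section
/- Let Y be a real inner product space and let S ⊆ Y be a convex set containing more than one point. Then the following are equivalent: (i) inf_{z∈S} ⟨z,y⟩ = −∞ for all y ∈ S∖{0}; (ii) for each convex function I : S → ℝ which is bounded above, the set of all global minima on S of the function x ↦ I(x) + ‖x‖² is either empty or equal to {0}. -/
open Set RealInnerProductSpace

/-- First-order condition for a minimum of `I + ‖·‖ ^ 2` with `I` convex. -/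
theorem ConvexOn.le_add_inner_of_forall_add_norm_sq_le {Y : Type*} [NormedAddCommGroup Y]
    [InnerProductSpace ℝ Y] {S : Set Y} {I : Y → ℝ} (hI : ConvexOn ℝ S I) {x z : Y}
    (hx : x ∈ S) (hz : z ∈ S) (hmin : ∀ w ∈ S, I x + ‖x‖ ^ 2 ≤ I w + ‖w‖ ^ 2) :
    I x ≤ I z + 2 * ⟪z - x, x⟫ := by
  by_contra! hlt
  set A := I x - (I z + 2 * ⟪z - x, x⟫) with hA
  set B := ‖z - x‖ ^ 2 with hB
  have hA0 : 0 < A := sub_pos.2 hlt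
  have hB0 : 0 ≤ B := sq_nonneg _
  have hAB : 0 < A + B := by positivity
  obtain ⟨t, ht⟩ : ∃ t, t = A / (A + B) := ⟨_, rfl⟩
  have ht0 : 0 < t := ht ▸ div_pos hA0 hAB
  have ht1 : t ≤ 1 := ht ▸ (div_le_one hAB).2 (by linarith)
  have htA : t * (A + B) = A := by rw [ht]; field_simp
  have hconv := hI.2 hx hz (sub_nonneg.2 ht1) ht0.le (by ring)
  have hle := hmin _ (hI.1 hx hz (sub_nonneg.2 ht1) ht0.le (by ring))
  have hpt : (1 - t) • x + t • z = x + t • (z - x) := by module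
  have hnorm : ‖(1 - t) • x + t • z‖ ^ 2 = ‖x‖ ^ 2 + 2 * (t * ⟪z - x, x⟫) + t ^ 2 * B := by
    rw [hpt, norm_add_sq_real, inner_smul_right, real_inner_comm, norm_smul, mul_pow,
      Real.norm_eq_abs, sq_abs]
  simp only [smul_eq_mul] at hconv
  have hmul : t * A ≤ t * (t * B) := by rw [hA]; nlinarith
  have hle' : A ≤ t * B := le_of_mul_le_mul_left hmul ht0
  nlinarith [mul_pos ht0 hA0]

theorem stmt16 {Y : Type*} [NormedAddCommGroup Y] [InnerProductSpace ℝ Y]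
    (S : Set Y) (hS : Convex ℝ S) (hS2 : ∃ a ∈ S, ∃ b ∈ S, a ≠ b) :
    (∀ y ∈ S, y ≠ 0 → ∀ c : ℝ, ∃ z ∈ S, ⟪z, y⟫ < c) ↔
    (∀ I : Y → ℝ, ConvexOn ℝ S I → BddAbove (I '' S) →
      {x ∈ S | ∀ z ∈ S, I x + ‖x‖ ^ 2 ≤ I z + ‖z‖ ^ 2} = ∅ ∨
      {x ∈ S | ∀ z ∈ S, I x + ‖x‖ ^ 2 ≤ I z + ‖z‖ ^ 2} = {0}) := by
  constructor
  · rintro h I hI ⟨M, hM⟩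
    rw [← Set.subset_singleton_iff_eq]
    rintro x ⟨hx, hmin⟩
    by_contra hx0
    obtain ⟨z, hz, hlt⟩ := h x hx hx0 ((I x - M) / 2 + ⟪x, x⟫)
    have hle := hI.le_add_inner_of_forall_add_norm_sq_le hx hz hmin
    have hIz : I z ≤ M := hM ⟨z, hz, rfl⟩
    rw [inner_sub_left] at hle
    linarith
  · intro h y hy hy0 c
    by_contra! hc
    have hconv : ConvexOn ℝ S fun z => -2 * ⟪z, y⟫ := by
      refine ⟨hS, fun u _ v _ a b _ _ _ => le_of_eq ?_⟩
      simp only [inner_add_left, real_inner_smul_left, smul_eq_mul]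
      ring
    have hbdd : BddAbove ((fun z => -2 * ⟪z, y⟫) '' S) := by
      refine ⟨-2 * c, ?_⟩
      rintro _ ⟨z, hz, rfl⟩
      have := hc z hz
      simp only
      linarith
    have hmem : y ∈ {x ∈ S | ∀ z ∈ S, -2 * ⟪x, y⟫ + ‖x‖ ^ 2 ≤ -2 * ⟪z, y⟫ + ‖z‖ ^ 2} := by
      refine ⟨hy, fun z _ => ?_⟩
      rw [real_inner_self_eq_norm_sq]
      nlinarith [norm_sub_sq_real z y, sq_nonneg ‖z - y‖]
    rcases h _ hconv hbdd with he | he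
    · exact (he ▸ hmem : y ∈ (∅ : Set Y))
    · exact hy0 (he ▸ hmem : y ∈ ({0} : Set Y))
end

section
/- Let X = {(t,s) ∈ ℝ² : t² + s² = 1}, Λ = {(μ,ν) ∈ ℝ² : μ² + ν² ≤ 1}, and f(t,s,μ,ν) = μt + νs for (t,s) ∈ X, (μ,ν) ∈ Λ. Then sup_{(μ,ν)∈Λ} inf_{(t,s)∈X} f(t,s,μ,ν) = 0 < 1 = inf_{(t,s)∈X} sup_{(μ,ν)∈Λ} f(t,s,μ,ν), and nevertheless, for each (μ,ν) ∈ Λ, every local minimum of the function (t,s) ↦ f(t,s,μ,ν) on X is a global minimum of that function on X. -/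
open Set

/-- A function `θ ↦ a cos θ + b sin θ` with a local minimum at `0` has `b = 0` and `a ≤ 0`. -/
theorem isLocalMin_cos_add_sin {a b : ℝ}
    (h : IsLocalMin (fun θ : ℝ => a * Real.cos θ + b * Real.sin θ) 0) : b = 0 ∧ a ≤ 0 := by
  have hd : HasDerivAt (fun θ : ℝ => a * Real.cos θ + b * Real.sin θ) b 0 := by
    simpa using
      ((Real.hasDerivAt_cos 0).const_mul a).fun_add ((Real.hasDerivAt_sin 0).const_mul b)
  have hb : b = 0 := h.hasDerivAt_eq_zero hd
  refine ⟨hb, ?_⟩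
  obtain ⟨ε, hε, hball⟩ := Metric.eventually_nhds_iff.1 h
  have hpos : 0 < min (ε / 2) 1 := by positivity
  have hθ : a ≤ a * Real.cos (min (ε / 2) 1) := by
    have hdist : dist (min (ε / 2) 1) 0 < ε := by
      rw [Real.dist_eq, sub_zero, abs_of_pos hpos]
      linarith [min_le_left (ε / 2) 1]
    simpa [hb] using hball hdist
  have hcos : Real.cos (min (ε / 2) 1) < 1 := by
    simpa using Real.cos_lt_cos_of_nonneg_of_le_pi le_rfl
      (by linarith [min_le_right (ε / 2) 1, Real.pi_gt_three]) hpos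
  nlinarith

/-- A local minimum of a linear form on the unit circle is a global minimum. -/
theorem le_of_isLocalMinOn_circle {q p p' : ℝ × ℝ} (hp : p.1 ^ 2 + p.2 ^ 2 = 1)
    (h : IsLocalMinOn (fun p : ℝ × ℝ => q.1 * p.1 + q.2 * p.2)
      {p : ℝ × ℝ | p.1 ^ 2 + p.2 ^ 2 = 1} p)
    (hp' : p'.1 ^ 2 + p'.2 ^ 2 = 1) :
    q.1 * p.1 + q.2 * p.2 ≤ q.1 * p'.1 + q.2 * p'.2 := by
  let γ : ℝ → ℝ × ℝ := fun θ =>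
    (p.1 * Real.cos θ - p.2 * Real.sin θ, p.2 * Real.cos θ + p.1 * Real.sin θ)
  have hγ0 : γ 0 = p := by simp [γ]
  have hγX : ∀ θ, γ θ ∈ {p : ℝ × ℝ | p.1 ^ 2 + p.2 ^ 2 = 1} := fun θ => by
    simp only [γ, mem_ofPred_eq]
    linear_combination (Real.cos θ ^ 2 + Real.sin θ ^ 2) * hp + Real.sin_sq_add_cos_sq θ
  have hγc : Continuous γ := by fun_prop
  have hγ : Filter.Tendsto γ (nhds 0)
      (nhdsWithin p {p : ℝ × ℝ | p.1 ^ 2 + p.2 ^ 2 = 1}) :=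
    tendsto_nhdsWithin_iff.2 ⟨hγ0 ▸ hγc.tendsto 0, Filter.Eventually.of_forall hγX⟩
  obtain ⟨hb, ha⟩ := isLocalMin_cos_add_sin
      (a := q.1 * p.1 + q.2 * p.2) (b := q.2 * p.1 - q.1 * p.2) <| by
    filter_upwards [hγ.eventually h] with θ hθ
    simp only [γ] at hθ
    simp only [Real.cos_zero, Real.sin_zero]
    linarith
  have hsq : (q.1 * p.1 + q.2 * p.2) ^ 2 = q.1 ^ 2 + q.2 ^ 2 := by
    linear_combination (q.1 ^ 2 + q.2 ^ 2) * hp - (q.2 * p.1 - q.1 * p.2) * hb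
  have hsq' : (q.1 * p'.1 + q.2 * p'.2) ^ 2 ≤ (-(q.1 * p.1 + q.2 * p.2)) ^ 2 := by
    have : (q.1 * p'.1 + q.2 * p'.2) ^ 2 + (q.2 * p'.1 - q.1 * p'.2) ^ 2 = q.1 ^ 2 + q.2 ^ 2 := by
      linear_combination (q.1 ^ 2 + q.2 ^ 2) * hp'
    nlinarith [sq_nonneg (q.2 * p'.1 - q.1 * p'.2)]
  linarith [(abs_le_of_sq_le_sq' hsq' (by linarith)).1]

theorem stmt17 (X : Set (ℝ × ℝ)) (hX : X = {p : ℝ × ℝ | p.1 ^ 2 + p.2 ^ 2 = 1})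
    (Λ : Set (ℝ × ℝ)) (hΛ : Λ = {q : ℝ × ℝ | q.1 ^ 2 + q.2 ^ 2 ≤ 1})
    (f : ℝ × ℝ → ℝ × ℝ → ℝ) (hf : ∀ p q, f p q = q.1 * p.1 + q.2 * p.2) :
    sSup ((fun q => sInf ((fun p => f p q) '' X)) '' Λ) = 0 ∧
    sInf ((fun p => sSup ((fun q => f p q) '' Λ)) '' X) = 1 ∧
    (∀ q ∈ Λ, ∀ p ∈ X, IsLocalMinOn (fun p => f p q) X p →
      ∀ p' ∈ X, f p q ≤ f p' q) := by
  subst hX hΛ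
  obtain rfl : f = fun p q => q.1 * p.1 + q.2 * p.2 := by
    funext p q
    exact hf p q
  have hne : {p : ℝ × ℝ | p.1 ^ 2 + p.2 ^ 2 = 1}.Nonempty := ⟨(1, 0), by simp⟩
  refine ⟨?_, ?_, fun q _ p hp h p' hp' => le_of_isLocalMinOn_circle hp h hp'⟩
  · refine IsGreatest.csSup_eq ⟨⟨(0, 0), by simp, ?_⟩, ?_⟩
    · simp [hne.image_const]
    · rintro _ ⟨q, hq, rfl⟩
      have hbdd : BddBelow ((fun p : ℝ × ℝ => q.1 * p.1 + q.2 * p.2) ''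
          {p : ℝ × ℝ | p.1 ^ 2 + p.2 ^ 2 = 1}) := by
        refine ⟨-1, ?_⟩
        rintro _ ⟨p, hp, rfl⟩
        simp only [mem_ofPred_eq] at hp hq ⊢
        nlinarith [sq_nonneg (q.1 + p.1), sq_nonneg (q.2 + p.2)]
      have h₁ := csInf_le hbdd ⟨(1, 0), by simp, rfl⟩
      have h₂ := csInf_le hbdd ⟨(-1, 0), by simp, rfl⟩
      simp only at h₁ h₂ ⊢
      linarith
  · have hsup : ∀ p ∈ {p : ℝ × ℝ | p.1 ^ 2 + p.2 ^ 2 = 1},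
        sSup ((fun q : ℝ × ℝ => q.1 * p.1 + q.2 * p.2) ''
          {q : ℝ × ℝ | q.1 ^ 2 + q.2 ^ 2 ≤ 1}) = 1 := by
      intro p hp
      refine IsGreatest.csSup_eq ⟨⟨p, le_of_eq hp, ?_⟩, ?_⟩
      · simp only [mem_ofPred_eq] at hp ⊢
        linarith
      · rintro _ ⟨q, hq, rfl⟩
        simp only [mem_ofPred_eq] at hp hq ⊢
        nlinarith [sq_nonneg (q.1 - p.1), sq_nonneg (q.2 - p.2)]
    rw [image_congr hsup, hne.image_const, csInf_singleton]
end

section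
/- Let X be a real normed space and J : X → ℝ a function, and set η = liminf_{‖x‖→+∞} J(x)/‖x‖². Then for every real μ < 2η and every λ ∈ X, one has lim_{‖x‖→+∞} ( J(x) − (μ/2)‖x − λ‖² ) = +∞. -/
theorem abs_norm_sub_sq_sub_norm_sq_le {X : Type*} [NormedAddCommGroup X] (x l : X) :
    |‖x - l‖ ^ 2 - ‖x‖ ^ 2| ≤ 2 * ‖x‖ * ‖l‖ + ‖l‖ ^ 2 := by
  have h1 := norm_sub_le x l
  have h2 := norm_sub_norm_le x l
  have h3 := norm_sub_norm_le x (x - l)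
  rw [sub_sub_cancel] at h3
  have := norm_nonneg x
  have := norm_nonneg l
  have := norm_nonneg (x - l)
  rw [abs_le]
  constructor <;> nlinarith

theorem stmt19 {X : Type*} [NormedAddCommGroup X] [NormedSpace ℝ X]
    (J : X → ℝ) (η : EReal)
    (hη : η = Filter.liminf (fun x => ((J x / ‖x‖ ^ 2 : ℝ) : EReal))
      (Filter.comap (fun x : X => ‖x‖) Filter.atTop))
    (μ : ℝ) (hμ : (μ : EReal) < 2 * η) (l : X) :
    ∀ M : ℝ, ∃ R > 0, ∀ x : X, R < ‖x‖ → M < J x - μ / 2 * ‖x - l‖ ^ 2 := by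
  intro M
  have half_lt : ((μ / 2 : ℝ) : EReal) < η := by
    by_contra! h
    have h2 : 2 * η ≤ 2 * ((μ / 2 : ℝ) : EReal) :=
      mul_le_mul_of_nonneg_left h (by norm_num)
    have h3 : 2 * ((μ / 2 : ℝ) : EReal) = (μ : EReal) := by
      rw [show (2 : EReal) = ((2 : ℝ) : EReal) from rfl, ← EReal.coe_mul]
      congr 1
      ring
    exact absurd hμ (not_lt.mpr (h3 ▸ h2))
  obtain ⟨c, hc, hcη⟩ := EReal.lt_iff_exists_real_btwn.mp half_lt
  rw [hη] at hcη
  have hev := Filter.eventually_lt_of_lt_liminf hcη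
  rw [Filter.eventually_comap, Filter.eventually_atTop] at hev
  obtain ⟨R₀, hR₀⟩ := hev
  have hd : 0 < c - μ / 2 := sub_pos.mpr (EReal.coe_lt_coe_iff.mp hc)
  set A := |μ / 2| * (2 * ‖l‖ + ‖l‖ ^ 2) + |M| with hA
  have hA0 : 0 ≤ A := by positivity
  refine ⟨max (max R₀ 1) (A / (c - μ / 2)), by positivity, fun x hx => ?_⟩
  obtain ⟨hx', hxA⟩ := max_lt_iff.mp hx
  obtain ⟨hxR, hx1⟩ := max_lt_iff.mp hx'
  have hJ : c < J x / ‖x‖ ^ 2 := EReal.coe_lt_coe_iff.mp (hR₀ _ hxR.le x rfl)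
  rw [lt_div_iff₀ (by positivity)] at hJ
  rw [div_lt_iff₀ hd] at hxA
  have hdiff : μ / 2 * (‖x - l‖ ^ 2 - ‖x‖ ^ 2) ≤ |μ / 2| * (2 * ‖x‖ * ‖l‖ + ‖l‖ ^ 2) := by
    refine (le_abs_self _).trans ?_
    rw [abs_mul]
    gcongr
    exact abs_norm_sub_sq_sub_norm_sq_le x l
  have hlin : |μ / 2| * (2 * ‖x‖ * ‖l‖ + ‖l‖ ^ 2) + M ≤ A * ‖x‖ := by
    have h1 : |μ / 2| * ‖l‖ ^ 2 ≤ |μ / 2| * ‖l‖ ^ 2 * ‖x‖ :=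
      le_mul_of_one_le_right (by positivity) hx1.le
    have h2 : |M| ≤ |M| * ‖x‖ := le_mul_of_one_le_right (abs_nonneg M) hx1.le
    have h3 := le_abs_self M
    rw [hA]
    linarith
  have hquad : A * ‖x‖ < (c - μ / 2) * ‖x‖ ^ 2 := by
    have := mul_lt_mul_of_pos_right hxA (zero_lt_one.trans hx1)
    linarith
  linarith
end
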